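/- arXiv:1608.06063 — 2 statements merged into one kernel-verified Lean document; each statement's English description precedes it below -/
import Mathlib

section
/- Define the Kashiwara operator $\tilde e_i$ ($1 \le i \le n$) on $B^{k,\infty}$ by $\tilde e_i(b)_{p,q} = b_{p,q} - \delta_{p,c_0}\delta_{q,i+1} + \delta_{p,c_0}\delta_{q,i}$ and $\tilde f_i(b)_{p,q} = b_{p,q} - \delta_{p,c_1}\delta_{q,i} + \delta_{p,c_1}\delta_{q,i+1}$, where $c_0, c_1$ are as defined from the minima of $\Gamma_i$. Then $\tilde e_i$ and $\tilde f_i$ map $B^{k,\infty}$ to itself and are mutually inverse bijections: $\tilde e_i \circ \tilde f_i = \tilde f_i \circ \tilde e_i = \mathrm{id}$. -/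
attribute [local instance] Classical.propDecidable

noncomputable section

/-- Validity of an index `(j,i)` of the arrays in `B^{k,∞}`. -/
def Bidx (n k j i : ℕ) : Prop := 1 ≤ j ∧ j ≤ k ∧ j ≤ i ∧ i ≤ j + (n + 1 - k)

/-- The crystal `B^{k,∞}`: integer arrays with zero row sums (entries outside
the defining range are taken to be `0`). -/
def BkInf (n k : ℕ) : Set (ℕ → ℕ → ℤ) :=
  {b | (∀ j i, ¬ Bidx n k j i → b j i = 0) ∧
    ∀ j, 1 ≤ j → j ≤ k → ∑ i ∈ Finset.Icc j (j + (n + 1 - k)), b j i = 0}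

/-- `β = max(0, i - k')`, with `k' = n+1-k` (truncated subtraction). -/
def betaI (n k i : ℕ) : ℕ := i - (n + 1 - k)

/-- `γ = min(k, i)`. -/
def gammaI (k i : ℕ) : ℕ := min k i

/-- `Γ_i(c) = ∑_{β < j < c} (b_{ji} - b_{j+1,i+1})`. -/
def Gam (b : ℕ → ℕ → ℤ) (i β c : ℕ) : ℤ :=
  ∑ j ∈ Finset.Ioo β c, (b j i - b (j + 1) (i + 1))

/-- The set of minimizers of `Γ_i` on `(β, γ]`. -/
def minSet (n k : ℕ) (b : ℕ → ℕ → ℤ) (i : ℕ) : Set ℕ :=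
  {c | betaI n k i < c ∧ c ≤ gammaI k i ∧
    ∀ c', betaI n k i < c' → c' ≤ gammaI k i →
      Gam b i (betaI n k i) c ≤ Gam b i (betaI n k i) c'}

/-- `c₀`: the smallest minimizer of `Γ_i`. -/
def czero (n k : ℕ) (b : ℕ → ℕ → ℤ) (i : ℕ) : ℕ := sInf (minSet n k b i)

/-- `c₁`: the largest minimizer of `Γ_i`. -/
def cone (n k : ℕ) (b : ℕ → ℕ → ℤ) (i : ℕ) : ℕ := sSup (minSet n k b i)

/-- The Kashiwara operator `ẽ_i` (`1 ≤ i ≤ n`):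
`ẽ_i(b)_{p,q} = b_{p,q} - δ_{p,c₀}δ_{q,i+1} + δ_{p,c₀}δ_{q,i}`. -/
def etil (n k i : ℕ) (b : ℕ → ℕ → ℤ) : ℕ → ℕ → ℤ := fun p q =>
  b p q - (if p = czero n k b i ∧ q = i + 1 then 1 else 0)
    + (if p = czero n k b i ∧ q = i then 1 else 0)

/-- The Kashiwara operator `f̃_i`:
`f̃_i(b)_{p,q} = b_{p,q} - δ_{p,c₁}δ_{q,i} + δ_{p,c₁}δ_{q,i+1}`. -/
def ftil (n k i : ℕ) (b : ℕ → ℕ → ℤ) : ℕ → ℕ → ℤ := fun p q =>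
  b p q - (if p = cone n k b i ∧ q = i then 1 else 0)
    + (if p = cone n k b i ∧ q = i + 1 then 1 else 0)

/-- Modification of `b` by `s` at `(p,i)` and by `-s` at `(p,i+1)`. -/
def modB (b : ℕ → ℕ → ℤ) (i p : ℕ) (s : ℤ) : ℕ → ℕ → ℤ := fun x y =>
  b x y + s * ((if x = p ∧ y = i then 1 else 0) - (if x = p ∧ y = i + 1 then 1 else 0))

lemma etil_eq (n k i : ℕ) (b : ℕ → ℕ → ℤ) : etil n k i b = modB b i (czero n k b i) 1 := by
  funext x y
  simp only [etil, modB]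
  ring

lemma ftil_eq (n k i : ℕ) (b : ℕ → ℕ → ℤ) : ftil n k i b = modB b i (cone n k b i) (-1) := by
  funext x y
  simp only [ftil, modB]
  ring

lemma modB_modB (b : ℕ → ℕ → ℤ) (i p : ℕ) (s t : ℤ) (h : s + t = 0) :
    modB (modB b i p s) i p t = b := by
  funext x y
  simp only [modB]
  have : t = -s := by linarith
  subst this
  ring

lemma Gam_modB (b : ℕ → ℕ → ℤ) (i p β c : ℕ) (s : ℤ) (hp : β < p) :
    Gam (modB b i p s) i β c = Gam b i β c +
      s * ((if p < c then 1 else 0) + (if β + 1 < p ∧ p ≤ c then 1 else 0)) := by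
  have h1 : ∀ j, modB b i p s j i - modB b i p s (j + 1) (i + 1) =
      (b j i - b (j + 1) (i + 1)) +
        s * ((if j = p then 1 else 0) + (if j = p - 1 then 1 else 0)) := by
    intro j
    have e : (j + 1 = p) ↔ (j = p - 1) := by omega
    simp [modB, e]
    split_ifs <;> ring
  unfold Gam
  rw [Finset.sum_congr rfl (fun j _ => h1 j), Finset.sum_add_distrib, ← Finset.mul_sum,
    Finset.sum_add_distrib, Finset.sum_ite_eq', Finset.sum_ite_eq']
  have e1 : p ∈ Finset.Ioo β c ↔ p < c := by simp [hp]
  have e2 : p - 1 ∈ Finset.Ioo β c ↔ (β + 1 < p ∧ p ≤ c) := by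
    rw [Finset.mem_Ioo]; omega
  simp only [e1, e2]

lemma minSet_nonempty (n k i : ℕ) (b : ℕ → ℕ → ℤ) (hk : 1 ≤ k) (hkn : k ≤ n) (hi : 1 ≤ i)
    (hin : i ≤ n) : (minSet n k b i).Nonempty := by
  have hne : (Finset.Ioc (betaI n k i) (gammaI k i)).Nonempty := by
    rw [Finset.nonempty_Ioc]; unfold betaI gammaI; omega
  obtain ⟨c, hc, hm⟩ := Finset.exists_min_image _ (Gam b i (betaI n k i)) hne
  rw [Finset.mem_Ioc] at hc
  exact ⟨c, hc.1, hc.2, fun c' h1 h2 => hm c' (Finset.mem_Ioc.2 ⟨h1, h2⟩)⟩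

lemma minSet_bdd (n k i : ℕ) (b : ℕ → ℕ → ℤ) : BddAbove (minSet n k b i) :=
  ⟨gammaI k i, fun _ h => h.2.1⟩

lemma modB_mem (n k i p : ℕ) (b : ℕ → ℕ → ℤ) (s : ℤ) (hkn : k ≤ n) (hb : b ∈ BkInf n k)
    (h1 : betaI n k i < p) (h2 : p ≤ gammaI k i) : modB b i p s ∈ BkInf n k := by
  unfold betaI at h1
  unfold gammaI at h2
  refine ⟨fun j q hj => ?_, fun j hj1 hj2 => ?_⟩
  · have e1 : ¬ (j = p ∧ q = i) := by
      rintro ⟨rfl, rfl⟩; apply hj; unfold Bidx; omega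
    have e2 : ¬ (j = p ∧ q = i + 1) := by
      rintro ⟨rfl, rfl⟩; apply hj; unfold Bidx; omega
    simp [modB, e1, e2, hb.1 j q hj]
  · simp only [modB]
    rw [Finset.sum_add_distrib, hb.2 j hj1 hj2, ← Finset.mul_sum, Finset.sum_sub_distrib]
    by_cases hjp : j = p
    · subst hjp
      simp only [true_and]
      rw [Finset.sum_ite_eq', Finset.sum_ite_eq', if_pos, if_pos]
      · simp
      · rw [Finset.mem_Icc]; omega
      · rw [Finset.mem_Icc]; omega
    · simp [hjp]

lemma cone_modB (n k i : ℕ) (b : ℕ → ℕ → ℤ) (h : (minSet n k b i).Nonempty) :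
    cone n k (modB b i (czero n k b i) 1) i = czero n k b i := by
  have hm : czero n k b i ∈ minSet n k b i := Nat.sInf_mem h
  have hl : ∀ c ∈ minSet n k b i, czero n k b i ≤ c := fun c hc => Nat.sInf_le hc
  generalize czero n k b i = p at hm hl ⊢
  obtain ⟨h1, h2, h3⟩ := hm
  have hlt : ∀ c, betaI n k i < c → c < p →
      Gam b i (betaI n k i) p + 1 ≤ Gam b i (betaI n k i) c := by
    intro c hc hcp
    by_contra hcon
    have := hl c ⟨hc, by omega, fun c' h h' => by have := h3 c' h h'; omega⟩
    omega
  refine IsGreatest.csSup_eq ⟨⟨h1, h2, fun c hc hc' => ?_⟩, fun c hc => ?_⟩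
  · rw [Gam_modB _ _ _ _ _ _ h1, Gam_modB _ _ _ _ _ _ h1]
    have := h3 c hc hc'
    have := hlt c hc
    split_ifs <;> omega
  · obtain ⟨hc1, hc2, hc3⟩ := hc
    have h4 := hc3 p h1 h2
    rw [Gam_modB _ _ _ _ _ _ h1, Gam_modB _ _ _ _ _ _ h1] at h4
    have := h3 c hc1 hc2
    by_contra hcon
    split_ifs at h4 <;> omega

lemma czero_modB (n k i : ℕ) (b : ℕ → ℕ → ℤ) (h : (minSet n k b i).Nonempty) :
    czero n k (modB b i (cone n k b i) (-1)) i = cone n k b i := by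
  have hm : cone n k b i ∈ minSet n k b i := Nat.sSup_mem h (minSet_bdd n k i b)
  have hl : ∀ c ∈ minSet n k b i, c ≤ cone n k b i :=
    fun c hc => le_csSup (minSet_bdd n k i b) hc
  generalize cone n k b i = p at hm hl ⊢
  obtain ⟨h1, h2, h3⟩ := hm
  have hlt : ∀ c, c ≤ gammaI k i → p < c →
      Gam b i (betaI n k i) p + 1 ≤ Gam b i (betaI n k i) c := by
    intro c hc hcp
    by_contra hcon
    have := hl c ⟨by omega, hc, fun c' h h' => by have := h3 c' h h'; omega⟩
    omega
  refine IsLeast.csInf_eq ⟨⟨h1, h2, fun c hc hc' => ?_⟩, fun c hc => ?_⟩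
  · rw [Gam_modB _ _ _ _ _ _ h1, Gam_modB _ _ _ _ _ _ h1]
    have := h3 c hc hc'
    have := hlt c hc'
    split_ifs <;> omega
  · obtain ⟨hc1, hc2, hc3⟩ := hc
    have h4 := hc3 p h1 h2
    rw [Gam_modB _ _ _ _ _ _ h1, Gam_modB _ _ _ _ _ _ h1] at h4
    have := h3 c hc1 hc2
    by_contra hcon
    split_ifs at h4 <;> omega

/-- `ẽ_i` and `f̃_i` map `B^{k,∞}` to itself and are mutually
inverse bijections on it: `ẽ_i ∘ f̃_i = f̃_i ∘ ẽ_i = id`. -/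
theorem stmt11 (n k i : ℕ) (hk : 1 ≤ k) (hkn : k ≤ n) (hi : 1 ≤ i) (hin : i ≤ n) :
    Set.MapsTo (etil n k i) (BkInf n k) (BkInf n k) ∧
    Set.MapsTo (ftil n k i) (BkInf n k) (BkInf n k) ∧
    ∀ b ∈ BkInf n k, etil n k i (ftil n k i b) = b ∧ ftil n k i (etil n k i b) = b := by
  have hne := fun b => minSet_nonempty n k i b hk hkn hi hin
  refine ⟨fun b hb => ?_, fun b hb => ?_, fun b _ => ⟨?_, ?_⟩⟩
  · have hm : czero n k b i ∈ minSet n k b i := Nat.sInf_mem (hne b)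
    rw [etil_eq]
    exact modB_mem n k i _ b 1 hkn hb hm.1 hm.2.1
  · have hm : cone n k b i ∈ minSet n k b i := Nat.sSup_mem (hne b) (minSet_bdd n k i b)
    rw [ftil_eq]
    exact modB_mem n k i _ b (-1) hkn hb hm.1 hm.2.1
  · rw [etil_eq, ftil_eq, czero_modB n k i b (hne b)]
    exact modB_modB _ _ _ _ _ (by norm_num)
  · rw [ftil_eq, etil_eq, cone_modB n k i b (hne b)]
    exact modB_modB _ _ _ _ _ (by norm_num)
end
end

section
/- Explicit $e_0$-action formula consistency: for positive reals $x = (x^{(l)}_m)$ on $L_1[n,k]$ and $c, d \in \mathbb{R}_{>0}$, define $(e_0^d x)^{(l)}_m = x^{(l)}_m \frac{\alpha^{(l)}_m(d)}{\alpha^{(l+1)}_m(d)}$ for $(l,m) \ne (1,n)$ and $(e_0^d x)^{(1)}_n = x^{(1)}_n / d$, where $\alpha^{(l)}_m(d) = U^{(l-1)}_m(x) + d\, V^{(l)}_m(x)$. Then $e_0^c \circ e_0^d = e_0^{cd}$, and the total path sum is invariant: $\varepsilon(e_0^d(x)) = \varepsilon(x)$. -/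
/- Lattice-path combinatorics on the weighted lattice `L₁[n,k]`.

A full shortest path from `(k,1)` to `(1,n)` is encoded by the strictly
increasing sequence `c : Fin (k+1) → Fin (n+2)` of its run boundaries (with
`c 0 = 1` and `c (last) = n+1`): the horizontal run on level `k - j` goes from
column `c j` to column `c (j+1) - 1`.  The run on level `l` (for `1 ≤ l ≤ k`)
thus occupies the columns `[c (k-l), c (k+1-l) - 1]`, so the path is strictly
above `(l,m)` iff `m < c (k-l)`, strictly below iff `c (k+1-l) ≤ m`, and
through `(l,m)` iff `c (k-l) ≤ m < c (k+1-l)`. -/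

attribute [local instance] Classical.propDecidable

noncomputable section

/-- Shortest partial paths from `(l,m)` to `(1,n)` on `L₁[n,k]`. -/
def pathsX (n l m : ℕ) : Finset (Fin (l + 1) → Fin (n + 2)) :=
  Finset.univ.filter fun c =>
    (c 0 : ℕ) = m ∧ StrictMono c ∧ (c (Fin.last l) : ℕ) = n + 1

/-- The weight of a path: product over its horizontal runs of `x_{i,start}/x_{i,end}`. -/
def wtX (x : ℕ → ℕ → ℚ) (l : ℕ) {n : ℕ} (c : Fin (l + 1) → Fin (n + 2)) : ℚ :=
  ∏ j : Fin l, x (l - (j : ℕ)) (c j.castSucc) / x (l - (j : ℕ)) ((c j.succ : ℕ) - 1)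

/-- `X^{(l)}_m`: the sum of the weights of all shortest paths from `(l,m)` to `(1,n)`.
In particular `ε = Xsum x n k 1` is the total sum over all full shortest paths. -/
def Xsum (x : ℕ → ℕ → ℚ) (n l m : ℕ) : ℚ :=
  ∑ c ∈ pathsX n l m, wtX x l c

/-- The `j`-th run boundary of a full path, as a natural number (clamped). -/
def cval {n k : ℕ} (c : Fin (k + 1) → Fin (n + 2)) (j : ℕ) : ℕ :=
  if h : j ≤ k then (c ⟨j, Nat.lt_succ_of_le h⟩ : ℕ) else n + 1

/-- `R^{(l)}_m`: sum of weights of full shortest paths through `(l,m)`. -/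
def Rsum (x : ℕ → ℕ → ℚ) (n k l m : ℕ) : ℚ :=
  ∑ c ∈ (pathsX n k 1).filter
      (fun c => cval c (k - l) ≤ m ∧ m < cval c (k + 1 - l)), wtX x k c

/-- `U^{(l)}_m`: sum of weights of full shortest paths strictly above `(l,m)`. -/
def Usum (x : ℕ → ℕ → ℚ) (n k l m : ℕ) : ℚ :=
  ∑ c ∈ (pathsX n k 1).filter (fun c => m < cval c (k - l)), wtX x k c

/-- `V^{(l)}_m`: sum of weights of full shortest paths strictly below `(l,m)`. -/
def Vsum (x : ℕ → ℕ → ℚ) (n k l m : ℕ) : ℚ :=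
  ∑ c ∈ (pathsX n k 1).filter (fun c => cval c (k + 1 - l) ≤ m), wtX x k c


/-- `α^{(l)}_m(d) := U^{(l-1)}_m + d ⬝ V^{(l)}_m`, with the boundary convention
`α^{(k+1)}_m(d) = d ⬝ ε` where applicable. -/
def alphaA (x : ℕ → ℕ → ℚ) (n k l m : ℕ) (d : ℚ) : ℚ :=
  if l ≤ k then Usum x n k (l - 1) m + d * Vsum x n k l m else d * Xsum x n k 1

/-- The explicit `0`-action `e₀^d`:
`(e₀^d x)^{(l)}_m = x^{(l)}_m ⬝ α^{(l)}_m(d)/α^{(l+1)}_m(d)` for lattice points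
`(l,m) ≠ (1,n)`, and `(e₀^d x)^{(1)}_n = x^{(1)}_n / d`. -/
def eZeroMap (x : ℕ → ℕ → ℚ) (n k : ℕ) (d : ℚ) : ℕ → ℕ → ℚ := fun l m =>
  if l = 1 ∧ m = n then x 1 n / d
  else if 1 ≤ l ∧ l ≤ k ∧ k < l + m ∧ l + m ≤ n + 1 then
    x l m * alphaA x n k l m d / alphaA x n k (l + 1) m d
  else x l m


def FF (y : ℕ → ℕ → ℚ) : ℕ → ℕ → ℚ
  | 0, a => if a = 1 then 1 else 0
  | j + 1, b => (∑ a ∈ Finset.range b, FF y j a * y j a) / y j (b - 1)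

def GGr (y : ℕ → ℕ → ℚ) (n k : ℕ) : ℕ → ℕ → ℚ
  | 0, a => if a = n + 1 then 1 else 0
  | i + 1, a => y (k - (i + 1)) a *
      ∑ b ∈ Finset.Ioc a (n + 1), GGr y n k i b / y (k - (i + 1)) (b - 1)

def GG (y : ℕ → ℕ → ℚ) (n k j a : ℕ) : ℚ := GGr y n k (k - j) a

def SS (y : ℕ → ℕ → ℚ) (j b : ℕ) : ℚ := ∑ a ∈ Finset.range b, FF y j a * y j a

def TT (y : ℕ → ℕ → ℚ) (n k j a : ℕ) : ℚ :=
  ∑ b ∈ Finset.Ioc a (n + 1), GG y n k (j + 1) b / y j (b - 1)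

def WW (y : ℕ → ℕ → ℚ) (n k j b : ℕ) : ℚ := ∑ a ∈ Finset.range b, FF y j a * GG y n k j a

def EE (y : ℕ → ℕ → ℚ) (n k : ℕ) : ℚ := WW y n k k (n + 2)

def BB (y : ℕ → ℕ → ℚ) (n k : ℕ) (d : ℚ) (j b : ℕ) : ℚ :=
  EE y n k + (d - 1) * WW y n k j b

lemma FF_succ (y : ℕ → ℕ → ℚ) (j b : ℕ) : FF y (j + 1) b = SS y j b / y j (b - 1) := rfl

lemma GG_top (y : ℕ → ℕ → ℚ) (n k a : ℕ) : GG y n k k a = if a = n + 1 then 1 else 0 := by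
  simp [GG, GGr]

lemma GG_lt (y : ℕ → ℕ → ℚ) (n k j a : ℕ) (h : j < k) :
    GG y n k j a = y j a * TT y n k j a := by
  obtain ⟨i, rfl⟩ : ∃ i, k = j + (i + 1) := ⟨k - j - 1, by omega⟩
  have h1 : j + (i + 1) - j = i + 1 := by omega
  have h2 : j + (i + 1) - (j + 1) = i := by omega
  have h3 : j + (i + 1) - (i + 1) = j := by omega
  simp only [GG, TT, h1, h2, GGr, h3]

lemma SS_succ (y : ℕ → ℕ → ℚ) (j b : ℕ) : SS y j (b + 1) = SS y j b + FF y j b * y j b := by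
  simp [SS, Finset.sum_range_succ]

lemma WW_succ (y : ℕ → ℕ → ℚ) (n k j b : ℕ) :
    WW y n k j (b + 1) = WW y n k j b + FF y j b * GG y n k j b := by
  simp [WW, Finset.sum_range_succ]

lemma sum_Ioc_step (f : ℕ → ℚ) (a N : ℕ) (h : a < N) :
    ∑ b ∈ Finset.Ioc a N, f b = f (a + 1) + ∑ b ∈ Finset.Ioc (a + 1) N, f b := by
  have : Finset.Ioc a N = insert (a + 1) (Finset.Ioc (a + 1) N) := by
    ext t; simp; omega
  rw [this, Finset.sum_insert (by simp)]

lemma TT_step (y : ℕ → ℕ → ℚ) (n k j a : ℕ) (h : a < n + 1) :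
    TT y n k j a = GG y n k (j + 1) (a + 1) / y j a + TT y n k j (a + 1) := by
  unfold TT
  rw [sum_Ioc_step _ _ _ h]; simp

lemma TT_end (y : ℕ → ℕ → ℚ) (n k j : ℕ) : TT y n k j (n + 1) = 0 := by simp [TT]

lemma FF_zero_right (y : ℕ → ℕ → ℚ) (j : ℕ) : FF y j 0 = 0 := by
  cases j <;> simp [FF]

lemma key (y : ℕ → ℕ → ℚ) (hy : ∀ i m, 0 < y i m) (n k j : ℕ) (hj : j < k) (b : ℕ)
    (hb : b ≤ n + 1) :
    WW y n k j b - WW y n k (j + 1) (b + 1) = SS y j b * TT y n k j b := by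
  induction b with
  | zero => simp [WW, SS, FF_zero_right]
  | succ b ih =>
    have ih := ih (by omega)
    have hne := (hy j b).ne'
    rw [WW_succ, WW_succ _ _ _ _ (b + 1), GG_lt _ _ _ _ _ hj, FF_succ]
    have h1 := TT_step y n k j b (by omega)
    have h2 := SS_succ y j b
    simp only [Nat.add_sub_cancel]
    have h3 : SS y j (b + 1) / y j b * GG y n k (j + 1) (b + 1) =
      SS y j (b + 1) * (TT y n k j b - TT y n k j (b + 1)) := by rw [h1]; ring
    rw [h3, h2]
    linear_combination ih

lemma WW_last (y : ℕ → ℕ → ℚ) (n k j : ℕ) (hj : j < k) :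
    WW y n k j (n + 2) = WW y n k j (n + 1) := by
  rw [WW_succ, GG_lt _ _ _ _ _ hj, TT_end]; simp

lemma WW_E (y : ℕ → ℕ → ℚ) (hy : ∀ i m, 0 < y i m) (n k j : ℕ) (hj : j ≤ k) :
    WW y n k j (n + 2) = EE y n k := by
  induction hj using Nat.decreasingInduction with
  | self => rfl
  | of_succ j hj ih =>
    rw [← ih, WW_last _ _ _ _ hj]
    have := key y hy n k j hj (n + 1) le_rfl
    rw [TT_end] at this
    linarith

lemma FF_nonneg (y : ℕ → ℕ → ℚ) (hy : ∀ i m, 0 < y i m) (j b : ℕ) : 0 ≤ FF y j b := by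
  induction j generalizing b with
  | zero => simp only [FF]; split_ifs <;> norm_num
  | succ j ih =>
    exact div_nonneg (Finset.sum_nonneg fun a _ => mul_nonneg (ih a) (hy _ _).le) (hy _ _).le

lemma FF_pos (y : ℕ → ℕ → ℚ) (hy : ∀ i m, 0 < y i m) (j b : ℕ) (hb : j + 2 ≤ b) :
    0 < FF y (j + 1) b := by
  have main : ∀ j, 0 < FF y j (j + 1) → ∀ b, j + 2 ≤ b → 0 < FF y (j + 1) b := by
    intro j hj b hb
    refine div_pos ?_ (hy _ _)
    refine Finset.sum_pos' (fun a _ => mul_nonneg (FF_nonneg y hy _ _) (hy _ _).le) ?_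
    exact ⟨j + 1, by simp; omega, mul_pos hj (hy _ _)⟩
  have diag : ∀ j, 0 < FF y j (j + 1) := by
    intro j
    induction j with
    | zero => simp [FF]
    | succ j ih => exact main j ih _ le_rfl
  exact main j (diag j) b hb

lemma GG_nonneg (y : ℕ → ℕ → ℚ) (hy : ∀ i m, 0 < y i m) (n k j a : ℕ) (hj : j ≤ k) :
    0 ≤ GG y n k j a := by
  induction hj using Nat.decreasingInduction generalizing a with
  | self => rw [GG_top]; split_ifs <;> norm_num
  | of_succ j hj ih =>
    rw [GG_lt _ _ _ _ _ hj]
    exact mul_nonneg (hy _ _).le (Finset.sum_nonneg fun b _ => div_nonneg (ih b) (hy _ _).le)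

lemma WW_top (y : ℕ → ℕ → ℚ) (n k : ℕ) : WW y n k k (n + 1) = 0 := by
  unfold WW
  refine Finset.sum_eq_zero fun a ha => ?_
  rw [GG_top, if_neg, mul_zero]
  simp at ha; omega

lemma EE_pos (y : ℕ → ℕ → ℚ) (hy : ∀ i m, 0 < y i m) (n k : ℕ) (hk : 1 ≤ k) (hkn : k ≤ n) :
    0 < EE y n k := by
  unfold EE
  rw [WW_succ, WW_top, GG_top]
  obtain ⟨j, rfl⟩ : ∃ j, k = j + 1 := ⟨k - 1, by omega⟩
  simpa using FF_pos y hy j (n + 1) (by omega)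

lemma WW_nonneg (y : ℕ → ℕ → ℚ) (hy : ∀ i m, 0 < y i m) (n k j b : ℕ) (hj : j ≤ k) :
    0 ≤ WW y n k j b :=
  Finset.sum_nonneg fun a _ => mul_nonneg (FF_nonneg y hy _ _) (GG_nonneg y hy _ _ _ _ hj)

lemma WW_le (y : ℕ → ℕ → ℚ) (hy : ∀ i m, 0 < y i m) (n k j b : ℕ) (hj : j ≤ k)
    (hb : b ≤ n + 2) : WW y n k j b ≤ EE y n k := by
  rw [← WW_E y hy n k j hj]
  refine Finset.sum_le_sum_of_subset_of_nonneg (by simpa using hb) ?_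
  exact fun a _ _ => mul_nonneg (FF_nonneg y hy _ _) (GG_nonneg y hy _ _ _ _ hj)

lemma BB_pos (y : ℕ → ℕ → ℚ) (hy : ∀ i m, 0 < y i m) (n k : ℕ) (hk : 1 ≤ k) (hkn : k ≤ n)
    (d : ℚ) (hd : 0 < d) (j b : ℕ) (hj : j ≤ k) (hb : b ≤ n + 2) : 0 < BB y n k d j b := by
  have h1 := EE_pos y hy n k hk hkn
  have h2 := WW_nonneg y hy n k j b hj
  have h3 := WW_le y hy n k j b hj hb
  have h4 : BB y n k d j b = (EE y n k - WW y n k j b) + d * WW y n k j b := by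
    unfold BB; ring
  rw [h4]
  rcases h2.eq_or_lt with h | h
  · rw [← h]; simpa using h1
  · have := mul_pos hd h
    linarith

def yP (y : ℕ → ℕ → ℚ) (n k : ℕ) (d : ℚ) (j m : ℕ) : ℚ :=
  y j m * BB y n k d (j + 1) (m + 1) / BB y n k d j (m + 1)

lemma BB_first (y : ℕ → ℕ → ℚ) (n k : ℕ) (d : ℚ) (j : ℕ) : BB y n k d j 1 = EE y n k := by
  simp [BB, WW, FF_zero_right]

lemma BB_succ (y : ℕ → ℕ → ℚ) (n k : ℕ) (d : ℚ) (j b : ℕ) :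
    BB y n k d j (b + 1) = BB y n k d j b + (d - 1) * (FF y j b * GG y n k j b) := by
  simp only [BB, WW_succ]; ring

lemma FF' (y : ℕ → ℕ → ℚ) (hy : ∀ i m, 0 < y i m) (n k : ℕ) (hk : 1 ≤ k) (hkn : k ≤ n)
    (d : ℚ) (hd : 0 < d) (j : ℕ) (hj : j ≤ k) (b : ℕ) (hb : b ≤ n + 1) :
    FF (yP y n k d) j b = EE y n k * FF y j b / BB y n k d j b := by
  have hB := BB_pos y hy n k hk hkn d hd
  induction j generalizing b with
  | zero =>
    simp only [FF]
    split_ifs with h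
    · subst h; rw [BB_first]
      have := (EE_pos y hy n k hk hkn).ne'
      field_simp
    · simp
  | succ j ih =>
    have hS : ∀ b, b ≤ n + 1 →
        SS (yP y n k d) j b = EE y n k * SS y j b / BB y n k d j b := by
      intro b hb
      induction b with
      | zero => simp [SS]
      | succ b ihb =>
        rw [SS_succ, SS_succ, ihb (by omega), ih (by omega) b (by omega)]
        have hK := key y hy n k j (by omega) b (by omega)
        have hb1 := BB_succ y n k d j b
        rw [GG_lt _ _ _ _ _ (by omega : j < k)] at hb1
        have h1 := (hB j b (by omega) (by omega)).ne'
        have h2 := (hB j (b + 1) (by omega) (by omega)).ne'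
        have h3 : BB y n k d (j + 1) (b + 1) =
            BB y n k d j b - (d - 1) * (SS y j b * TT y n k j b) := by
          rw [← hK]; simp only [BB]; ring
        unfold yP
        rw [h3]
        field_simp
        rw [hb1]
        ring
    cases b with
    | zero => simp [FF_zero_right]
    | succ b =>
      rw [FF_succ, FF_succ, hS _ hb]
      have h1 := (hB j (b + 1) (by omega) (by omega)).ne'
      have h2 := (hB (j + 1) (b + 1) (by omega) (by omega)).ne'
      have h3 := (hy j b).ne'
      simp only [Nat.add_sub_cancel, yP]
      field_simp

lemma GG' (y : ℕ → ℕ → ℚ) (hy : ∀ i m, 0 < y i m) (n k : ℕ) (hk : 1 ≤ k) (hkn : k ≤ n)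
    (d : ℚ) (hd : 0 < d) (j : ℕ) (hj : j ≤ k) (a : ℕ) (ha : a ≤ n + 1) :
    GG (yP y n k d) n k j a = d * EE y n k * GG y n k j a / BB y n k d j (a + 1) := by
  have hB := BB_pos y hy n k hk hkn d hd
  induction hj using Nat.decreasingInduction generalizing a with
  | self =>
    rw [GG_top, GG_top]
    split_ifs with h
    · subst h
      have : BB y n k d k (n + 1 + 1) = d * EE y n k := by
        simp only [BB]
        rw [WW_E y hy n k k le_rfl]; ring
      rw [this, mul_one, div_self]
      exact (mul_pos hd (EE_pos y hy n k hk hkn)).ne'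
    · simp
  | of_succ j hj ih =>
    have hT : ∀ a, a ≤ n + 1 → TT (yP y n k d) n k j a =
        d * EE y n k * TT y n k j a / BB y n k d (j + 1) (a + 1) := by
      intro a ha
      induction ha using Nat.decreasingInduction with
      | self => simp [TT_end]
      | of_succ a ha iha =>
        rw [TT_step _ _ _ _ _ ha, TT_step y _ _ _ _ ha, iha, ih (a + 1) ha]
        have h0 := (hB j (a + 1) (by omega) (by omega)).ne'
        have h1 := (hB (j + 1) (a + 1) (by omega) (by omega)).ne'
        have h2 := (hB (j + 1) (a + 1 + 1) (by omega) (by omega)).ne'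
        have h3 := (hy j a).ne'
        have hK := key y hy n k j (by omega) (a + 1) (by omega)
        have hb1 := BB_succ y n k d (j + 1) (a + 1)
        rw [FF_succ, Nat.add_sub_cancel] at hb1
        have h4 : BB y n k d j (a + 1) =
            BB y n k d (j + 1) (a + 1 + 1) +
              (d - 1) * (SS y j (a + 1) * TT y n k j (a + 1)) := by
          rw [← hK]; simp only [BB]; ring
        have h5 : BB y n k d (j + 1) (a + 1) = BB y n k d (j + 1) (a + 1 + 1) - 
            (d - 1) * (SS y j (a + 1) / y j a * GG y n k (j + 1) (a + 1)) := by
          rw [hb1]; ring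
        have h6 : GG y n k (j + 1) (a + 1) * BB y n k d j (a + 1) +
            y j a * BB y n k d (j + 1) (a + 1) * TT y n k j (a + 1) = 
            BB y n k d (j + 1) (a + 1 + 1) *
              (GG y n k (j + 1) (a + 1) + y j a * TT y n k j (a + 1)) := by
          rw [h4, h5]; field_simp; ring
        unfold yP
        field_simp
        linear_combination EE y n k * h6
    rw [GG_lt _ _ _ _ _ hj, GG_lt _ _ _ _ _ hj, hT a ha]
    have h1 := (hB j (a + 1) (by omega) (by omega)).ne'
    have h2 := (hB (j + 1) (a + 1) (by omega) (by omega)).ne'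
    unfold yP
    field_simp

lemma WW' (y : ℕ → ℕ → ℚ) (hy : ∀ i m, 0 < y i m) (n k : ℕ) (hk : 1 ≤ k) (hkn : k ≤ n)
    (d : ℚ) (hd : 0 < d) (j : ℕ) (hj : j ≤ k) (b : ℕ) (hb : b ≤ n + 2) :
    WW (yP y n k d) n k j b = d * EE y n k * WW y n k j b / BB y n k d j b := by
  have hB := BB_pos y hy n k hk hkn d hd
  induction b with
  | zero => simp [WW]
  | succ b ih =>
    rw [WW_succ, ih (by omega), FF' y hy n k hk hkn d hd j hj b (by omega),
      GG' y hy n k hk hkn d hd j hj b (by omega), WW_succ]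
    have h1 := (hB j b (by omega) (by omega)).ne'
    have h2 := (hB j (b + 1) (by omega) (by omega)).ne'
    field_simp
    rw [BB_succ]
    simp only [BB]
    ring

lemma BB_last (y : ℕ → ℕ → ℚ) (hy : ∀ i m, 0 < y i m) (n k : ℕ) (d : ℚ) (j : ℕ) (hj : j ≤ k) :
    BB y n k d j (n + 2) = d * EE y n k := by
  simp only [BB, WW_E y hy n k j hj]; ring

lemma EE' (y : ℕ → ℕ → ℚ) (hy : ∀ i m, 0 < y i m) (n k : ℕ) (hk : 1 ≤ k) (hkn : k ≤ n)
    (d : ℚ) (hd : 0 < d) : EE (yP y n k d) n k = EE y n k := by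
  have h1 := (EE_pos y hy n k hk hkn).ne'
  rw [EE, WW' y hy n k hk hkn d hd k le_rfl _ le_rfl, BB_last y hy n k d k le_rfl]
  rw [WW_E y hy n k k le_rfl]
  field_simp

lemma BB' (y : ℕ → ℕ → ℚ) (hy : ∀ i m, 0 < y i m) (n k : ℕ) (hk : 1 ≤ k) (hkn : k ≤ n)
    (d : ℚ) (hd : 0 < d) (c : ℚ) (j : ℕ) (hj : j ≤ k) (b : ℕ) (hb : b ≤ n + 2) :
    BB (yP y n k d) n k c j b = EE y n k * BB y n k (c * d) j b / BB y n k d j b := by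
  have h1 := (BB_pos y hy n k hk hkn d hd j b hj hb).ne'
  rw [BB, EE' y hy n k hk hkn d hd, WW' y hy n k hk hkn d hd j hj b hb]
  field_simp
  simp only [BB]
  ring

/- Transfer from path sums. -/

def Fphi (φ y : ℕ → ℕ → ℚ) : ℕ → ℕ → ℚ
  | 0, a => φ 0 a * if a = 1 then 1 else 0
  | j + 1, b => φ (j + 1) b * ((∑ a ∈ Finset.range b, Fphi φ y j a * y j a) / y j (b - 1))

def pw (φ y : ℕ → ℕ → ℚ) (n j : ℕ) (c : Fin (j + 1) → Fin (n + 2)) : ℚ :=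
  (∏ i : Fin (j + 1), φ i (c i)) * ∏ i : Fin j, y i (c i.castSucc) / y i ((c i.succ : ℕ) - 1)

lemma strictMono_snoc (n j : ℕ) (c : Fin (j + 1) → Fin (n + 2)) (a : Fin (n + 2)) :
    StrictMono (Fin.snoc c a : Fin (j + 2) → Fin (n + 2)) ↔
      StrictMono c ∧ c (Fin.last j) < a := by
  rw [Fin.strictMono_iff_lt_succ, Fin.strictMono_iff_lt_succ, Fin.forall_fin_succ']
  have h1 : ∀ i : Fin j, i.castSucc.succ = i.succ.castSucc := fun i => rfl
  have h2 : (Fin.last j).succ = Fin.last (j + 1) := rfl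
  have h3 : ∀ i : Fin (j + 1), (Fin.snoc c a : Fin (j + 2) → Fin (n + 2)) i.castSucc = c i :=
    fun i => Fin.snoc_castSucc (α := fun _ => Fin (n + 2)) a c i
  have h4 : (Fin.snoc c a : Fin (j + 2) → Fin (n + 2)) (Fin.last (j + 1)) = a :=
    Fin.snoc_last (α := fun _ => Fin (n + 2)) a c
  simp only [h1, h2, h3, h4]

lemma pw_snoc (φ y : ℕ → ℕ → ℚ) (n j : ℕ) (c : Fin (j + 1) → Fin (n + 2)) (a : Fin (n + 2)) :
    pw φ y n (j + 1) (Fin.snoc c a : Fin (j + 2) → Fin (n + 2)) =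
      pw φ y n j c * (φ (j + 1) a * (y j (c (Fin.last j)) / y j ((a : ℕ) - 1))) := by
  have h1 : ∀ i : Fin j, i.castSucc.succ = i.succ.castSucc := fun i => rfl
  have h2 : (Fin.last j).succ = Fin.last (j + 1) := rfl
  have h3 : ∀ i : Fin (j + 1), (Fin.snoc c a : Fin (j + 2) → Fin (n + 2)) i.castSucc = c i :=
    fun i => Fin.snoc_castSucc (α := fun _ => Fin (n + 2)) a c i
  have h4 : (Fin.snoc c a : Fin (j + 2) → Fin (n + 2)) (Fin.last (j + 1)) = a :=
    Fin.snoc_last (α := fun _ => Fin (n + 2)) a c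
  unfold pw
  rw [Fin.prod_univ_castSucc (n := j + 1),
    Fin.prod_univ_castSucc (n := j) (f := fun i : Fin (j + 1) => y i _ / _)]
  simp only [h1, h2, h3, h4, Fin.val_castSucc, Fin.val_last]
  ring

lemma sum_snoc (n j : ℕ) (f : (Fin (j + 2) → Fin (n + 2)) → ℚ) :
    ∑ c, f c = ∑ a : Fin (n + 2), ∑ c : Fin (j + 1) → Fin (n + 2), f (Fin.snoc c a) := by
  rw [← (Fin.snocEquiv (fun _ : Fin (j + 2) => Fin (n + 2))).sum_comp, Fintype.sum_prod_type]
  rfl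

lemma transfer (φ y : ℕ → ℕ → ℚ) (n j : ℕ) (b : Fin (n + 2)) :
    (∑ c : Fin (j + 1) → Fin (n + 2),
      if (c 0 : ℕ) = 1 ∧ StrictMono c ∧ c (Fin.last j) = b then pw φ y n j c else 0)
      = Fphi φ y j b := by
  induction j generalizing b with
  | zero =>
    rw [← (Equiv.funUnique (Fin 1) (Fin (n + 2))).symm.sum_comp]
    have : ∀ f : Fin 1 → Fin (n + 2), StrictMono f := fun f => Subsingleton.strictMono f
    rw [Finset.sum_eq_single b]
    · simp [this, pw, Fphi]
    · intro a _ hab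
      rw [if_neg]
      rintro ⟨-, -, h⟩
      exact hab h
    · simp
  | succ j ih =>
    rw [sum_snoc, Finset.sum_eq_single b]
    · have h4 : ∀ c : Fin (j + 1) → Fin (n + 2),
        (Fin.snoc c b : Fin (j + 2) → Fin (n + 2)) (Fin.last (j + 1)) = b :=
        fun c => Fin.snoc_last (α := fun _ => Fin (n + 2)) b c
      have h0 : ∀ c : Fin (j + 1) → Fin (n + 2),
        (Fin.snoc c b : Fin (j + 2) → Fin (n + 2)) 0 = c 0 :=
        fun c => Fin.snoc_castSucc (α := fun _ => Fin (n + 2)) b c 0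
      simp only [h4, h0, strictMono_snoc, pw_snoc, and_true]
      simp only [Fphi]
      have hr : ∑ a ∈ Finset.range b, Fphi φ y j a * y j a =
          ∑ a : Fin (n + 2), if a < b then Fphi φ y j a * y j a else 0 := by
        have e1 := Finset.sum_range (n := n + 2)
          (fun a : ℕ => if a < (b : ℕ) then Fphi φ y j a * y j a else 0)
        simp only [Fin.lt_def]
        rw [← e1, ← Finset.sum_filter]
        congr 1
        ext t; simp; have := b.2; omega
      rw [hr]
      simp only [← ih]
      rw [Finset.sum_div, Finset.mul_sum]
      have hins : ∀ c : Fin (j + 1) → Fin (n + 2),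
          (if (c 0 : ℕ) = 1 ∧ StrictMono c ∧ c (Fin.last j) < b then
            pw φ y n j c * (φ (j + 1) b * (y j (c (Fin.last j)) / y j ((b : ℕ) - 1))) else 0) =
          ∑ a : Fin (n + 2), if a < b then
            (if (c 0 : ℕ) = 1 ∧ StrictMono c ∧ c (Fin.last j) = a then pw φ y n j c else 0) *
              (φ (j + 1) b * (y j a / y j ((b : ℕ) - 1))) else 0 := by
        intro c
        rw [Finset.sum_eq_single (c (Fin.last j))]
        · by_cases h1 : (c 0 : ℕ) = 1 <;> by_cases h2 : StrictMono c <;>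
            by_cases h3 : c (Fin.last j) < b <;> simp [h1, h2, h3]
        · intro a _ ha
          rw [if_neg (c := _ ∧ _) (fun h => ha h.2.2.symm)]; simp
        · simp
      rw [Finset.sum_congr rfl fun c _ => hins c, Finset.sum_comm]
      refine Finset.sum_congr rfl fun a _ => ?_
      split_ifs with h
      · rw [← Finset.sum_mul]; ring
      · simp
    · intro a _ hab
      refine Finset.sum_eq_zero fun c _ => ?_
      rw [if_neg]
      rintro ⟨-, -, h⟩
      rw [Fin.snoc_last (α := fun _ => Fin (n + 2)) a c] at h
      exact hab h
    · simp

lemma Fphi_eq (h : ℕ → ℚ) (y : ℕ → ℕ → ℚ) (i j a : ℕ) (hij : j < i) :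
    Fphi (fun t a => if t = i then h a else 1) y j a = FF y j a := by
  induction j generalizing a with
  | zero => simp [Fphi, FF, hij.ne]
  | succ j ih =>
    simp only [Fphi, FF, if_neg hij.ne, one_mul]
    congr 1
    exact Finset.sum_congr rfl fun a _ => by rw [ih a (by omega)]

lemma Fphi_at (h : ℕ → ℚ) (y : ℕ → ℕ → ℚ) (i a : ℕ) :
    Fphi (fun t a => if t = i then h a else 1) y i a = h a * FF y i a := by
  cases i with
  | zero => simp [Fphi, FF]
  | succ j =>
    simp only [Fphi, FF, if_true]
    congr 2
    exact Finset.sum_congr rfl fun a _ => by rw [Fphi_eq _ _ _ _ _ (by omega)]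

lemma Fphi_step (h : ℕ → ℚ) (y : ℕ → ℕ → ℚ) (n k i j : ℕ) (hij : i ≤ j) (hjk : j < k) :
    ∑ a ∈ Finset.range (n + 2), Fphi (fun t a => if t = i then h a else 1) y j a * GG y n k j a =
    ∑ a ∈ Finset.range (n + 2),
      Fphi (fun t a => if t = i then h a else 1) y (j + 1) a * GG y n k (j + 1) a := by
  simp only [GG_lt y n k j _ hjk, TT]
  simp only [Fphi, if_neg (by omega : ¬ j + 1 = i), one_mul]
  simp only [Finset.mul_sum, Finset.sum_div, Finset.sum_mul]
  rw [Finset.sum_comm' (t' := Finset.range (n + 2)) (s' := fun b => Finset.range b)]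
  · refine Finset.sum_congr rfl fun b _ => Finset.sum_congr rfl fun a _ => ?_
    ring
  · intro a b; simp; omega

lemma Fphi_total (h : ℕ → ℚ) (y : ℕ → ℕ → ℚ) (n k i : ℕ) (hik : i ≤ k) :
    Fphi (fun t a => if t = i then h a else 1) y k (n + 1) =
      ∑ a ∈ Finset.range (n + 2), h a * FF y i a * GG y n k i a := by
  have : ∀ j, i ≤ j → j ≤ k →
    ∑ a ∈ Finset.range (n + 2), Fphi (fun t a => if t = i then h a else 1) y j a * GG y n k j a =
      ∑ a ∈ Finset.range (n + 2), h a * FF y i a * GG y n k i a := by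
    intro j hij
    induction j, hij using Nat.le_induction with
    | base => intro _; simp only [Fphi_at]
    | succ j hij ih => intro hj; rw [← Fphi_step _ _ _ _ _ _ hij (by omega), ih (by omega)]
  rw [← this k hik le_rfl]
  simp [GG_top]

/-- Agreement of `x` and `y` on the lattice. -/
def Agree (n k : ℕ) (x y : ℕ → ℕ → ℚ) : Prop :=
  ∀ j m, j < k → j < m → m + k ≤ n + 1 + j → x (k - j) m = y j m

lemma path_bounds (n k : ℕ) (c : Fin (k + 1) → Fin (n + 2)) (hc : c ∈ pathsX n k 1)
    (i : Fin (k + 1)) : (i : ℕ) + 1 ≤ c i ∧ (c i : ℕ) + k ≤ n + 1 + i := by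
  simp only [pathsX, Finset.mem_filter, Finset.mem_univ, true_and] at hc
  obtain ⟨h0, hm, hl⟩ := hc
  have hm' : ∀ i (h : i + 1 < k + 1), (c ⟨i, by omega⟩ : ℕ) < c ⟨i + 1, h⟩ := fun i h =>
    hm (by simp [Fin.lt_def])
  constructor
  · obtain ⟨i, hi⟩ := i
    induction i with
    | zero => simp only [zero_add]; exact h0.ge
    | succ i ih => have := ih (by omega); have := hm' i hi; simp only at *; omega
  · obtain ⟨i, hi⟩ := i
    have : i ≤ k := by omega
    induction this using Nat.decreasingInduction with
    | self => have : (c ⟨k, hi⟩ : ℕ) = n + 1 := hl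
              simp only; omega
    | of_succ i hik ih => have := ih (by omega); have := hm' i (by omega); simp only at *; omega

lemma wt_eq (n k : ℕ) (x y : ℕ → ℕ → ℚ) (hxy : Agree n k x y)
    (c : Fin (k + 1) → Fin (n + 2)) (hc : c ∈ pathsX n k 1) :
    wtX x k c = ∏ i : Fin k, y i (c i.castSucc) / y i ((c i.succ : ℕ) - 1) := by
  unfold wtX
  refine Finset.prod_congr rfl fun i _ => ?_
  have h1 := path_bounds n k c hc i.castSucc
  have h2 := path_bounds n k c hc i.succ
  have hm : (c i.castSucc : ℕ) < c i.succ := by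
    simp only [pathsX, Finset.mem_filter, Finset.mem_univ, true_and] at hc
    exact hc.2.1 (Fin.castSucc_lt_succ)
  simp only [Fin.val_castSucc, Fin.val_succ] at h1 h2
  rw [hxy i _ i.2 (by omega) (by omega), hxy i _ i.2 (by omega) (by omega)]

lemma psum (n k : ℕ) (x y : ℕ → ℕ → ℚ) (hxy : Agree n k x y) (h : ℕ → ℚ) (i : ℕ) (hi : i ≤ k) :
    ∑ c ∈ pathsX n k 1, h (cval c i) * wtX x k c =
      ∑ a ∈ Finset.range (n + 2), h a * FF y i a * GG y n k i a := by
  rw [← Fphi_total h y n k i hi]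
  have := transfer (fun t a => if t = i then h a else 1) y n k (Fin.last (n + 1))
  rw [Fin.val_last] at this
  rw [← this, ← Finset.sum_filter]
  refine Finset.sum_congr ?_ ?_
  · ext c
    simp [pathsX, Fin.ext_iff]
  · intro c hc
    replace hc : c ∈ pathsX n k 1 := by
      simpa [pathsX, Fin.ext_iff] using hc
    rw [wt_eq n k x y hxy c hc, pw]
    congr 1
    rw [Finset.prod_eq_single (⟨i, by omega⟩ : Fin (k + 1))]
    · simp [cval, hi]
    · intro t _ ht
      rw [if_neg]
      intro h'; exact ht (Fin.ext h')
    · simp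

lemma Vsum_eq (n k : ℕ) (x y : ℕ → ℕ → ℚ) (hxy : Agree n k x y) (l m : ℕ)
    (hl1 : 1 ≤ l) (hm : m ≤ n + 1) :
    Vsum x n k l m = WW y n k (k + 1 - l) (m + 1) := by
  have := psum n k x y hxy (fun a => if a ≤ m then 1 else 0) (k + 1 - l) (by omega)
  simp only [ite_mul, one_mul, zero_mul] at this
  rw [Vsum, Finset.sum_filter, this, ← Finset.sum_filter, WW]
  congr 1
  ext t; simp; omega

lemma Xsum_eq (n k : ℕ) (x y : ℕ → ℕ → ℚ) (hxy : Agree n k x y) :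
    Xsum x n k 1 = EE y n k := by
  have := psum n k x y hxy (fun a => 1) k le_rfl
  simp only [one_mul] at this
  exact this

lemma Usum_eq (n k : ℕ) (x y : ℕ → ℕ → ℚ) (hxy : Agree n k x y) (l m : ℕ)
    (hl1 : 1 ≤ l) (hl : l ≤ k) (hm : m ≤ n + 1) :
    Usum x n k (l - 1) m = EE y n k - WW y n k (k + 1 - l) (m + 1) := by
  rw [← Xsum_eq n k x y hxy, ← Vsum_eq n k x y hxy l m hl1 hm, Usum, Vsum, Xsum,
    (by omega : k - (l - 1) = k + 1 - l), eq_sub_iff_add_eq, add_comm]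
  simp only [← not_le]
  exact Finset.sum_filter_add_sum_filter_not _ _ _

lemma alpha_eq (n k : ℕ) (x y : ℕ → ℕ → ℚ) (hxy : Agree n k x y)
    (hE : WW y n k 0 (n + 2) = EE y n k) (l m : ℕ) (d : ℚ)
    (hl1 : 1 ≤ l) (hl : l ≤ k + 1) (hm1 : 1 ≤ m) (hm : m ≤ n + 1) :
    alphaA x n k l m d = BB y n k d (k + 1 - l) (m + 1) := by
  unfold alphaA
  split_ifs with h
  · rw [Usum_eq n k x y hxy l m hl1 h hm, Vsum_eq n k x y hxy l m hl1 hm, BB]; ring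
  · obtain rfl : l = k + 1 := by omega
    have : ∀ t, WW y n k 0 (t + 2) = GG y n k 0 1 := by
      intro t
      unfold WW
      rw [Finset.sum_eq_single 1] <;> simp +contextual [FF]
    obtain ⟨m, rfl⟩ : ∃ t, m = t + 1 := ⟨m - 1, by omega⟩
    rw [Xsum_eq n k x y hxy, BB, Nat.sub_self, this m, ← this n, hE]; ring

lemma eZero_eq (n k : ℕ) (hk : 1 ≤ k) (hkn : k ≤ n) (x y : ℕ → ℕ → ℚ) (hxy : Agree n k x y)
    (hE : WW y n k 0 (n + 2) = EE y n k) (hE1 : WW y n k (k - 1) (n + 2) = EE y n k)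
    (hE0 : EE y n k ≠ 0) (d : ℚ) (hd : d ≠ 0) (l m : ℕ)
    (hl1 : 1 ≤ l) (hl : l ≤ k) (hlm : k < l + m) (hlm2 : l + m ≤ n + 1) :
    eZeroMap x n k d l m = yP y n k d (k - l) m := by
  have hx : x l m = y (k - l) m := by
    have := hxy (k - l) m (by omega) (by omega) (by omega)
    rwa [(by omega : k - (k - l) = l)] at this
  unfold eZeroMap
  split_ifs with h h2
  · obtain ⟨rfl, rfl⟩ := h
    have e1 : BB y m k d k (m + 1) = EE y m k := by simp [BB, WW_top]
    have e2 : BB y m k d (k - 1) (m + 1) = d * EE y m k := by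
      rw [BB, ← WW_last _ _ _ _ (by omega), hE1]; ring
    rw [yP, hx, (by omega : k - 1 + 1 = k), e1, e2]
    field_simp
  · rw [alpha_eq n k x y hxy hE l m d hl1 (by omega) (by omega) (by omega),
      alpha_eq n k x y hxy hE (l + 1) m d (by omega) (by omega) (by omega) (by omega), hx, yP,
      (by omega : k + 1 - l = k - l + 1), (by omega : k + 1 - (l + 1) = k - l)]
  · exact absurd ⟨hl1, hl, hlm, hlm2⟩ h2

/-- the `0`-action satisfies the one-parameter group law
`e₀^c ∘ e₀^d = e₀^{cd}`, and it leaves the total path sum invariant: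
`ε(e₀^d(x)) = ε(x)`. -/
theorem stmt17 (n k : ℕ) (hk : 1 ≤ k) (hkn : k ≤ n)
    (x : ℕ → ℕ → ℚ)
    (hx : ∀ i j, 1 ≤ i → i ≤ k → k < i + j → i + j ≤ n + 1 → 0 < x i j)
    (c d : ℚ) (hc : 0 < c) (hd : 0 < d) :
    (∀ l m, eZeroMap (eZeroMap x n k d) n k c l m = eZeroMap x n k (c * d) l m) ∧
    Xsum (eZeroMap x n k d) n k 1 = Xsum x n k 1 := by
  classical
  set y : ℕ → ℕ → ℚ := fun j m =>
    if j < k ∧ j < m ∧ m + k ≤ n + 1 + j then x (k - j) m else 1 with hy_def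
  have hxy : Agree n k x y := by
    intro j m h1 h2 h3
    simp only [hy_def]
    rw [if_pos ⟨h1, h2, h3⟩]
  have hy : ∀ i m, 0 < y i m := by
    intro i m
    simp only [hy_def]
    split_ifs with h
    · exact hx _ _ (by omega) (by omega) (by omega) (by omega)
    · norm_num
  have hcd : 0 < c * d := mul_pos hc hd
  have hE0 := (EE_pos y hy n k hk hkn).ne'
  have hB := BB_pos y hy n k hk hkn d hd
  have hlat := fun (d : ℚ) (hd : 0 < d) => eZero_eq n k hk hkn x y hxy
    (WW_E y hy n k 0 (by omega)) (WW_E y hy n k (k - 1) (by omega)) hE0 d hd.ne'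
  have hxy' : Agree n k (eZeroMap x n k d) (yP y n k d) := by
    intro j m h1 h2 h3
    rw [hlat d hd (k - j) m (by omega) (by omega) (by omega) (by omega),
      (by omega : k - (k - j) = j)]
  have hEE := EE' y hy n k hk hkn d hd
  have hW' : ∀ j ≤ k, WW (yP y n k d) n k j (n + 2) = EE (yP y n k d) n k := by
    intro j hj
    rw [hEE, WW' y hy n k hk hkn d hd j hj _ le_rfl, BB_last y hy n k d j hj,
      WW_E y hy n k j hj]
    field_simp
  refine ⟨?_, ?_⟩
  · intro l m
    by_cases h : 1 ≤ l ∧ l ≤ k ∧ k < l + m ∧ l + m ≤ n + 1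
    · obtain ⟨h1, h2, h3, h4⟩ := h
      rw [hlat (c * d) hcd l m h1 h2 h3 h4,
        eZero_eq n k hk hkn _ _ hxy' (hW' 0 (by omega)) (hW' (k - 1) (by omega))
          (by rw [hEE]; exact hE0) c hc.ne' l m h1 h2 h3 h4]
      have b1 := (hB (k - l) (m + 1) (by omega) (by omega)).ne'
      have b2 := (hB (k - l + 1) (m + 1) (by omega) (by omega)).ne'
      have b3 := (BB_pos y hy n k hk hkn (c * d) hcd (k - l) (m + 1) (by omega) (by omega)).ne'
      rw [yP, BB' y hy n k hk hkn d hd c (k - l) (by omega) (m + 1) (by omega),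
        BB' y hy n k hk hkn d hd c (k - l + 1) (by omega) (m + 1) (by omega), yP, yP]
      field_simp
    · have h' : ¬ (l = 1 ∧ m = n) := by
        rintro ⟨rfl, rfl⟩
        exact h ⟨le_rfl, hk, by omega, by omega⟩
      simp only [eZeroMap, if_neg h, if_neg h']
  · rw [Xsum_eq n k _ _ hxy', hEE, Xsum_eq n k x y hxy]
end
end
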